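/- arXiv:1208.1822 — 2 statements merged into one kernel-verified Lean document; each statement's English description precedes it below -/
import Mathlib

section
/- Let I ⊂ S = K[x_1,…,x_n] be a nonzero lexsegment ideal generated by monomials of degree d. If μ(I) > ξ_{n−1}, where ξ_k = Σ_{j=1}^k C(2j−1, j), then in the multigraded (Z^n-graded) case the Hilbert depth satisfies hdepth_n(I) = 1. -/
noncomputable section

open MvPolynomial

/-- The total degree of an exponent vector. -/
def edeg {n : ℕ} (a : Fin n →₀ ℕ) : ℕ := ∑ i, a i

/-- An exponent vector is squarefree if every exponent is at most 1. -/
def IsSqfree {n : ℕ} (a : Fin n →₀ ℕ) : Prop := ∀ i, a i ≤ 1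

/-- The set of exponent vectors of monomials belonging to the ideal `I`. -/
def expSet {K : Type} [Field K] {n : ℕ} (I : Ideal (MvPolynomial (Fin n) K)) :
    Set (Fin n →₀ ℕ) := {a | (monomial a (1 : K)) ∈ I}

/-- `I` is generated by monomials `x^a` with `a` satisfying the predicate `P`. -/
def GenBy {K : Type} [Field K] {n : ℕ} (I : Ideal (MvPolynomial (Fin n) K))
    (P : (Fin n →₀ ℕ) → Prop) : Prop :=
  ∃ G : Set (Fin n →₀ ℕ), (∀ a ∈ G, P a) ∧
    I = Ideal.span ((fun a => (monomial a (1 : K))) '' G)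

/-- `I` is a monomial ideal. -/
def IsMonomialIdeal {K : Type} [Field K] {n : ℕ} (I : Ideal (MvPolynomial (Fin n) K)) : Prop :=
  GenBy I fun _ => True

/-- `I` is a squarefree monomial ideal. -/
def IsSqfreeMonomialIdeal {K : Type} [Field K] {n : ℕ}
    (I : Ideal (MvPolynomial (Fin n) K)) : Prop := GenBy I IsSqfree

/-- `x^a >_lex x^b` in the lexicographic order with `x_1 > x_2 > ⋯ > x_n`. -/
def lexGT {n : ℕ} (a b : Fin n →₀ ℕ) : Prop :=
  ∃ i : Fin n, (∀ j : Fin n, j < i → a j = b j) ∧ b i < a i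

/-- `I` is a lexsegment ideal. -/
def IsLexsegment {K : Type} [Field K] {n : ℕ} (I : Ideal (MvPolynomial (Fin n) K)) : Prop :=
  IsMonomialIdeal I ∧ ∀ a b : Fin n →₀ ℕ, (monomial a (1 : K)) ∈ I → edeg b = edeg a →
    lexGT b a → (monomial b (1 : K)) ∈ I

/-- `I` is a squarefree lexsegment ideal. -/
def IsSqfreeLexsegment {K : Type} [Field K] {n : ℕ}
    (I : Ideal (MvPolynomial (Fin n) K)) : Prop :=
  IsSqfreeMonomialIdeal I ∧ ∀ a b : Fin n →₀ ℕ, IsSqfree a → IsSqfree b →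
    (monomial a (1 : K)) ∈ I → edeg b = edeg a → lexGT b a → (monomial b (1 : K)) ∈ I

/-- The minimal number of generators of an ideal. -/
def mu {K : Type} [Field K] {n : ℕ} (I : Ideal (MvPolynomial (Fin n) K)) : ℕ :=
  sInf {m | ∃ G : Finset (MvPolynomial (Fin n) K), G.card = m ∧ I = Ideal.span (G : Set _)}

/-- `ξ_k = ∑_{j=1}^k C(2j-1, j)`. -/
def xi (k : ℕ) : ℕ := ∑ j ∈ Finset.Icc 1 k, (2 * j - 1).choose j

/-- The Hilbert function of `I`: the `K`-dimension of the degree-`j` component of `I`. -/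
def hilb {K : Type} [Field K] {n : ℕ} (I : Ideal (MvPolynomial (Fin n) K)) (j : ℕ) : ℕ :=
  Module.finrank K ↥((Submodule.restrictScalars K I) ⊓ homogeneousSubmodule (Fin n) K j)

/-- The Hilbert function of `I` extended to all integer degrees. -/
def hilbZ {K : Type} [Field K] {n : ℕ} (I : Ideal (MvPolynomial (Fin n) K)) (j : ℤ) : ℕ :=
  if 0 ≤ j then hilb I j.toNat else 0

/-- The Hilbert function of a standard graded polynomial ring in `d` variables,
at degree `t ∈ ℤ`. -/
def polyHilb (d : ℕ) (t : ℤ) : ℕ :=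
  if t < 0 then 0 else if d = 0 then (if t = 0 then 1 else 0) else (t.toNat + (d - 1)).choose (d - 1)

/-- A (standard graded) Hilbert decomposition of `I` all of whose retracts are polynomial
rings in at least `k` variables: `I ≅ ⊕ᵢ Sᵢ(-sᵢ)` as graded `K`-vector spaces, where `Sᵢ`
is a graded algebra retract of `S`, i.e. a polynomial ring in `dd i ≥ k` variables. -/
def HilbertDecomp1 {K : Type} [Field K] {n : ℕ} (I : Ideal (MvPolynomial (Fin n) K))
    (k : ℕ) : Prop :=
  ∃ (ι : Type) (_ : Fintype ι) (dd : ι → ℕ) (s : ι → ℤ),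
    (∀ i, k ≤ dd i) ∧ ∀ j : ℤ, hilbZ I j = ∑ i, polyHilb (dd i) (j - s i)

/-- The Hilbert depth of `I` in the standard graded sense. -/
def hdepth1 {K : Type} [Field K] {n : ℕ} (I : Ideal (MvPolynomial (Fin n) K)) : ℕ∞ :=
  sSup {k : ℕ∞ | ∃ m : ℕ, HilbertDecomp1 I m ∧ k = m}

/-- The set of exponent vectors `u + ℕ^Z`, corresponding to the Stanley space `x^u K[Z]`. -/
def cone {n : ℕ} (u : Fin n →₀ ℕ) (Z : Finset (Fin n)) : Set (Fin n →₀ ℕ) :=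
  {a | (∀ j, u j ≤ a j) ∧ ∀ j ∉ Z, a j = u j}

/-- A Stanley decomposition, with all Stanley spaces of dimension at least `k`, of the
`ℤⁿ`-graded module whose monomial basis has exponent set `A`. -/
def StanleyPartN {n : ℕ} (A : Set (Fin n →₀ ℕ)) (k : ℕ) : Prop :=
  ∃ (ι : Type) (_ : Fintype ι) (u : ι → (Fin n →₀ ℕ)) (Z : ι → Finset (Fin n)),
    (∀ i, k ≤ (Z i).card) ∧ (∀ i, cone (u i) (Z i) ⊆ A) ∧
    (∀ a ∈ A, ∃! i, a ∈ cone (u i) (Z i))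

/-- The multigraded Stanley depth of the `ℤⁿ`-graded module whose monomial basis has
exponent set `A`. -/
def sdepthN {n : ℕ} (A : Set (Fin n →₀ ℕ)) : ℕ∞ :=
  sSup {k : ℕ∞ | ∃ m : ℕ, StanleyPartN A m ∧ k = m}

/-- A multigraded Hilbert decomposition of the monomial ideal `I`, with all retracts
polynomial rings in at least `k` variables: the multigraded Hilbert function of `I`
(which takes values 0 and 1) equals the sum of the multigraded Hilbert functions of
the shifted retracts `x^{u i} K[Z i]`. -/
def HilbertDecompN {K : Type} [Field K] {n : ℕ} (I : Ideal (MvPolynomial (Fin n) K))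
    (k : ℕ) : Prop :=
  ∃ (ι : Type) (_ : Fintype ι) (u : ι → (Fin n →₀ ℕ)) (Z : ι → Finset (Fin n)),
    (∀ i, k ≤ (Z i).card) ∧
    (∀ a : Fin n →₀ ℕ, (a ∈ expSet I ↔ ∃ i, a ∈ cone (u i) (Z i)) ∧
      (∀ i i', a ∈ cone (u i) (Z i) → a ∈ cone (u i') (Z i') → i = i'))

/-- The multigraded Hilbert depth of a monomial ideal `I`. -/
def hdepthN {K : Type} [Field K] {n : ℕ} (I : Ideal (MvPolynomial (Fin n) K)) : ℕ∞ :=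
  sSup {k : ℕ∞ | ∃ m : ℕ, HilbertDecompN I m ∧ k = m}

/-- The graded maximal ideal `(x_1, …, x_n)`. -/
def maxIdeal (K : Type) [Field K] (n : ℕ) : Ideal (MvPolynomial (Fin n) K) :=
  Ideal.span (Set.range X)

/-- The depth of a module `M` over `S = K[x_1,…,x_n]` with respect to the graded maximal
ideal: the supremum of lengths of `M`-regular sequences in `(x_1,…,x_n)`. -/
def mdepth (K : Type) [Field K] (n : ℕ) (M : Type)
    [AddCommGroup M] [Module (MvPolynomial (Fin n) K) M] : ℕ∞ :=
  sSup {k : ℕ∞ | ∃ rs : List (MvPolynomial (Fin n) K),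
    (∀ r ∈ rs, r ∈ maxIdeal K n) ∧ RingTheory.Sequence.IsRegular M rs ∧ k = rs.length}

/-- The quotient module `I/J` for ideals `J ≤ I`. -/
def quotMod {K : Type} [Field K] {n : ℕ} (I J : Ideal (MvPolynomial (Fin n) K)) : Type :=
  ↥I ⧸ (Submodule.comap (Submodule.subtype I) J)

instance {K : Type} [Field K] {n : ℕ} (I J : Ideal (MvPolynomial (Fin n) K)) :
    AddCommGroup (quotMod I J) := by unfold quotMod; infer_instance

instance {K : Type} [Field K] {n : ℕ} (I J : Ideal (MvPolynomial (Fin n) K)) :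
    Module (MvPolynomial (Fin n) K) (quotMod I J) := by unfold quotMod; infer_instance

/-- `ρ_j(I\J)`: the number of squarefree monomials of degree `j` in `I ∖ J`. -/
def rho {K : Type} [Field K] {n : ℕ} (I J : Ideal (MvPolynomial (Fin n) K)) (j : ℕ) : ℕ :=
  Set.ncard {a : Fin n →₀ ℕ | IsSqfree a ∧ edeg a = j ∧ a ∈ expSet I ∧ a ∉ expSet J}

/-- `ρ_j(I)`: the number of squarefree monomials of degree `j` in `I`. -/
def rhoI {K : Type} [Field K] {n : ℕ} (I : Ideal (MvPolynomial (Fin n) K)) (j : ℕ) : ℕ :=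
  Set.ncard {a : Fin n →₀ ℕ | IsSqfree a ∧ edeg a = j ∧ a ∈ expSet I}

/-- `I` is a stable monomial ideal. Here `j` plays the role of `m(u)`, the largest index of
a variable dividing `u = x^a`. -/
def IsStable {K : Type} [Field K] {n : ℕ} (I : Ideal (MvPolynomial (Fin n) K)) : Prop :=
  IsMonomialIdeal I ∧ ∀ a : Fin n →₀ ℕ, (monomial a (1 : K)) ∈ I →
    ∀ j : Fin n, a j ≠ 0 → (∀ l, j < l → a l = 0) → ∀ i, i < j →
      (monomial (a + Finsupp.single i 1 - Finsupp.single j 1) (1 : K)) ∈ I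

/-- `I` is a squarefree stable monomial ideal. -/
def IsSqfreeStable {K : Type} [Field K] {n : ℕ} (I : Ideal (MvPolynomial (Fin n) K)) : Prop :=
  IsSqfreeMonomialIdeal I ∧ ∀ a : Fin n →₀ ℕ, IsSqfree a → (monomial a (1 : K)) ∈ I →
    ∀ j : Fin n, a j ≠ 0 → (∀ l, j < l → a l = 0) → ∀ i, i < j → a i = 0 →
      (monomial (a + Finsupp.single i 1 - Finsupp.single j 1) (1 : K)) ∈ I

/-- `I` is a squarefree strongly stable monomial ideal. -/
def IsSqfreeStronglyStable {K : Type} [Field K] {n : ℕ}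
    (I : Ideal (MvPolynomial (Fin n) K)) : Prop :=
  IsSqfreeMonomialIdeal I ∧ ∀ a : Fin n →₀ ℕ, IsSqfree a → (monomial a (1 : K)) ∈ I →
    ∀ i : Fin n, a i ≠ 0 → ∀ j, j < i → a j = 0 →
      (monomial (a + Finsupp.single j 1 - Finsupp.single i 1) (1 : K)) ∈ I

/-- The exponent vectors of the minimal monomial generators of a monomial ideal:
the monomials of `I` minimal with respect to divisibility. -/
def minGens {K : Type} [Field K] {n : ℕ} (I : Ideal (MvPolynomial (Fin n) K)) :
    Set (Fin n →₀ ℕ) := {a | a ∈ expSet I ∧ ∀ b ∈ expSet I, b ≤ a → b = a}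

/-- `m(u)`: the largest index (1-based) of a variable dividing `x^a`; `0` if `a = 0`. -/
def mvar {n : ℕ} (a : Fin n →₀ ℕ) : ℕ := a.support.sup (fun i => (i : ℕ) + 1)

/-- `m(I) = max { m(u) : u ∈ G(I) }`. -/
def mIdeal {K : Type} [Field K] {n : ℕ} (I : Ideal (MvPolynomial (Fin n) K)) : ℕ :=
  sSup {m | ∃ a ∈ minGens I, m = mvar a}

open MvPolynomial

/-- The `K`-subspace `Aᵢ·xᵢ` of `S`, where `Aᵢ` is the subalgebra generated by `B`. -/
def stSpace {K : Type} [Field K] {n : ℕ} (B : Finset (MvPolynomial (Fin n) K))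
    (x : MvPolynomial (Fin n) K) : Submodule K (MvPolynomial (Fin n) K) :=
  (Subalgebra.toSubmodule (Algebra.adjoin K (B : Set (MvPolynomial (Fin n) K)))).map
    (LinearMap.mulLeft K x)

/-- A standard graded Stanley decomposition of the ideal `I` with all Stanley spaces of
depth at least `k`: a finite family of graded algebra retracts `Sᵢ = K[Bᵢ]` (generated by
`k ≤ |Bᵢ|` linearly independent linear forms) and homogeneous elements `xᵢ ∈ I` with
`Sᵢ ∩ ann(xᵢ) = 0`, such that `I = ⊕ᵢ Sᵢ xᵢ` as graded `K`-vector spaces. -/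
def StanleyDecomp1 {K : Type} [Field K] {n : ℕ} (I : Ideal (MvPolynomial (Fin n) K))
    (k : ℕ) : Prop :=
  ∃ (ι : Type) (_ : Fintype ι) (B : ι → Finset (MvPolynomial (Fin n) K))
    (x : ι → MvPolynomial (Fin n) K) (d : ι → ℕ),
      (∀ i, ∀ b ∈ B i, b ∈ homogeneousSubmodule (Fin n) K 1) ∧
      (∀ i, LinearIndependent K (fun b : (B i : Set (MvPolynomial (Fin n) K)) =>
        (b : MvPolynomial (Fin n) K))) ∧
      (∀ i, k ≤ (B i).card) ∧
      (∀ i, x i ∈ I) ∧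
      (∀ i, x i ∈ homogeneousSubmodule (Fin n) K (d i)) ∧
      (∀ i, ∀ a ∈ Algebra.adjoin K ((B i : Set (MvPolynomial (Fin n) K))),
        a * x i = 0 → a = 0) ∧
      (iSup (fun i => stSpace (B i) (x i)) = Submodule.restrictScalars K I) ∧
      (iSupIndep fun i => stSpace (B i) (x i))

/-- The standard graded Stanley depth of `I`. -/
def sdepth1 {K : Type} [Field K] {n : ℕ} (I : Ideal (MvPolynomial (Fin n) K)) : ℕ∞ :=
  sSup {k : ℕ∞ | ∃ m : ℕ, StanleyDecomp1 I m ∧ k = m}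

/-- The subspace `S₁ · V` of `S`. -/
def mulS1 {K : Type} [Field K] {n : ℕ} (V : Submodule K (MvPolynomial (Fin n) K)) :
    Submodule K (MvPolynomial (Fin n) K) :=
  Submodule.span K {p | ∃ l ∈ homogeneousSubmodule (Fin n) K 1, ∃ v ∈ V, p = l * v}

/-- A lexsegment set of monomials of degree `d`. -/
def IsLexSet {n : ℕ} (d : ℕ) (L : Set (Fin n →₀ ℕ)) : Prop :=
  (∀ a ∈ L, edeg a = d) ∧ ∀ a ∈ L, ∀ b : Fin n →₀ ℕ, edeg b = d → lexGT b a → b ∈ L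

/-- `V ⊆ S_d` is a Gotzmann space: `dim_K (S₁·V) = dim_K (S₁·lex(V))`, where `lex(V)` is
spanned by the lexsegment set of monomials of degree `d` of cardinality `dim_K V`. -/
def IsGotzmannSpace {K : Type} [Field K] {n : ℕ} (d : ℕ)
    (V : Submodule K (MvPolynomial (Fin n) K)) : Prop :=
  ∃ L : Finset (Fin n →₀ ℕ), IsLexSet (n := n) d (L : Set (Fin n →₀ ℕ)) ∧ L.card = Module.finrank K ↥V ∧
    Module.finrank K ↥(mulS1 V) =
      Module.finrank K ↥(mulS1 (Submodule.span K
        ((fun a => (monomial a (1 : K))) '' (L : Set (Fin n →₀ ℕ)))))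

/-- `I` is a homogeneous ideal in the standard grading. -/
def IsHomogeneousIdeal {K : Type} [Field K] {n : ℕ}
    (I : Ideal (MvPolynomial (Fin n) K)) : Prop :=
  ∀ p ∈ I, ∀ k : ℕ, homogeneousComponent k p ∈ I

/-- `I` is a Gotzmann ideal: each homogeneous component `I_k` is a Gotzmann space. -/
def IsGotzmannIdeal {K : Type} [Field K] {n : ℕ}
    (I : Ideal (MvPolynomial (Fin n) K)) : Prop :=
  IsHomogeneousIdeal I ∧ ∀ k : ℕ,
    IsGotzmannSpace k ((Submodule.restrictScalars K I) ⊓ homogeneousSubmodule (Fin n) K k)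

/-- `I` is generated by homogeneous elements of degree `d`. -/
def GenInDegHomog {K : Type} [Field K] {n : ℕ} (I : Ideal (MvPolynomial (Fin n) K))
    (d : ℕ) : Prop :=
  ∃ G : Set (MvPolynomial (Fin n) K), (∀ g ∈ G, g ∈ homogeneousSubmodule (Fin n) K d) ∧
    I = Ideal.span G

theorem edeg_add {n : ℕ} (a b : Fin n →₀ ℕ) : edeg (a + b) = edeg a + edeg b := by
  simp [edeg, Finset.sum_add_distrib]

theorem edeg_single {n : ℕ} (i : Fin n) (k : ℕ) : edeg (Finsupp.single i k) = k := by
  simp [edeg, Finsupp.single_apply]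

theorem edeg_le_of_le {n : ℕ} {a b : Fin n →₀ ℕ} (h : a ≤ b) : edeg a ≤ edeg b :=
  Finset.sum_le_sum fun i _ => h i

theorem eq_of_le_of_edeg_le {n : ℕ} {a b : Fin n →₀ ℕ} (h : a ≤ b) (hd : edeg b ≤ edeg a) :
    a = b := by
  obtain ⟨c, rfl⟩ := exists_add_of_le h
  rw [edeg_add] at hd
  have hc : edeg c = 0 := by omega
  have : c = 0 := by
    ext i
    exact Finset.sum_eq_zero_iff.mp hc i (Finset.mem_univ i)
  simp [this]

theorem mem_finsuppAntidiag_univ {n D : ℕ} {a : Fin n →₀ ℕ} :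
    a ∈ (Finset.univ : Finset (Fin n)).finsuppAntidiag D ↔ edeg a = D := by
  simp [Finset.mem_finsuppAntidiag, edeg]

theorem lexGT_or_lexGT_of_ne {n : ℕ} {a b : Fin n →₀ ℕ} (h : a ≠ b) :
    lexGT a b ∨ lexGT b a := by
  have hne : ∃ i, a i ≠ b i := by
    by_contra! hc
    exact h (Finsupp.ext hc)
  obtain ⟨i, hi, hmin⟩ := WellFounded.has_min (wellFounded_lt (α := Fin n)) {i | a i ≠ b i} hne
  have heq : ∀ j < i, a j = b j := fun j hj => by
    by_contra hc
    exact hmin j hc hj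
  rcases lt_or_gt_of_ne hi with hlt | hgt
  · exact Or.inr ⟨i, fun j hj => (heq j hj).symm, hlt⟩
  · exact Or.inl ⟨i, heq, hgt⟩

theorem lexGT_add_single_self {n : ℕ} (a : Fin n →₀ ℕ) (j : Fin n) :
    lexGT (a + Finsupp.single j 1) a :=
  ⟨j, fun l hl => by simp [hl.ne'], by simp⟩

theorem lexGT.add_single {n : ℕ} {a e : Fin n →₀ ℕ} (h : lexGT a e) (j : Fin n) :
    lexGT (a + Finsupp.single j 1) e := by
  obtain ⟨i, heq, hlt⟩ := h
  rcases lt_or_ge j i with hji | hij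
  · refine ⟨j, fun l hl => ?_, ?_⟩
    · simp [hl.ne', heq l (hl.trans hji)]
    · simp [heq j hji]
  · refine ⟨i, fun l hl => ?_, ?_⟩
    · simp [(hl.trans_le hij).ne', heq l hl]
    · simpa using Nat.lt_add_right _ hlt

/-- The smallest exponent vector which agrees with `e` before the coordinate `i` and exceeds `e`
at `i`. -/
def lexBump {n : ℕ} (e : Fin n →₀ ℕ) (i : Fin n) : Fin n →₀ ℕ :=
  Finsupp.equivFunOnFinite.symm fun j => if j < i then e j else if j = i then e i + 1 else 0

theorem lexBump_apply {n : ℕ} (e : Fin n →₀ ℕ) (i j : Fin n) :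
    lexBump e i j = if j < i then e j else if j = i then e i + 1 else 0 := rfl

open Classical in
/-- The exponent vectors of degree `D` which agree with `e` before the coordinate `i` and
exceed `e` at `i`. -/
def lexGTAt {n : ℕ} (e : Fin n →₀ ℕ) (D : ℕ) (i : Fin n) : Finset (Fin n →₀ ℕ) :=
  (Finset.univ.finsuppAntidiag D).filter fun a => (∀ j < i, a j = e j) ∧ e i < a i

theorem mem_lexGTAt {n D : ℕ} {e a : Fin n →₀ ℕ} {i : Fin n} :
    a ∈ lexGTAt e D i ↔ edeg a = D ∧ (∀ j < i, a j = e j) ∧ e i < a i := by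
  simp [lexGTAt, edeg]

theorem lexBump_le {n : ℕ} {e a : Fin n →₀ ℕ} {i : Fin n} (h : ∀ j < i, a j = e j)
    (hi : e i < a i) : lexBump e i ≤ a := by
  intro j
  rw [lexBump_apply]
  split_ifs with h1 h2
  · exact (h j h1).ge
  · subst h2; exact hi
  · exact Nat.zero_le _

theorem card_lexGTAt_of_lt {n D : ℕ} {e : Fin n →₀ ℕ} {i : Fin n} (hD : D < edeg (lexBump e i)) :
    (lexGTAt e D i).card = 0 := by
  rw [Finset.card_eq_zero, Finset.eq_empty_iff_forall_notMem]
  intro a ha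
  obtain ⟨had, h, hi⟩ := mem_lexGTAt.mp ha
  have := edeg_le_of_le (lexBump_le h hi)
  omega

theorem card_lexGTAt {n m : ℕ} (e : Fin n →₀ ℕ) (i : Fin n) :
    (lexGTAt e (edeg (lexBump e i) + m) i).card = (n - i + m - 1).choose m := by
  have : lexGTAt e (edeg (lexBump e i) + m) i =
      ((Finset.Ici i).finsuppAntidiag m).map (addLeftEmbedding (lexBump e i)) := by
    ext a
    simp only [mem_lexGTAt, Finset.mem_map, Finset.mem_finsuppAntidiag, addLeftEmbedding_apply]
    constructor
    · rintro ⟨had, h, hi⟩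
      obtain ⟨b, rfl⟩ := exists_add_of_le (lexBump_le h hi)
      have hb : b.support ⊆ Finset.Ici i := by
        intro j hj
        rw [Finset.mem_Ici]
        by_contra! hji
        have := h j hji
        rw [Finsupp.add_apply, lexBump_apply, if_pos hji] at this
        exact Finsupp.mem_support_iff.mp hj (by omega)
      refine ⟨b, ⟨?_, hb⟩, rfl⟩
      rw [edeg_add] at had
      rw [← Nat.add_left_cancel had, edeg]
      exact Finset.sum_subset (Finset.subset_univ _) fun j _ hj =>
        Finsupp.notMem_support_iff.mp fun hc => hj (hb hc)
    · rintro ⟨b, ⟨hsum, hb⟩, rfl⟩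
      refine ⟨?_, fun j hj => ?_, ?_⟩
      · rw [edeg_add, ← hsum, Nat.add_left_cancel_iff, edeg]
        exact (Finset.sum_subset (Finset.subset_univ _) fun j _ hj =>
          Finsupp.notMem_support_iff.mp fun hc => hj (hb hc)).symm
      · have : b j = 0 := Finsupp.notMem_support_iff.mp fun hc =>
          absurd (Finset.mem_Ici.mp (hb hc)) (not_le.mpr hj)
        simp [lexBump_apply, hj, this]
      · simp [lexBump_apply]
        omega
  rw [this, Finset.card_map, Finset.card_finsuppAntidiag_nat_eq_choose, Fin.card_Ici]

open Classical in
/-- The exponent vectors of degree `D` lexicographically larger than `e`. -/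
def lexAbove {n : ℕ} (e : Fin n →₀ ℕ) (D : ℕ) : Finset (Fin n →₀ ℕ) :=
  (Finset.univ.finsuppAntidiag D).filter fun a => lexGT a e

theorem mem_lexAbove {n D : ℕ} {e a : Fin n →₀ ℕ} :
    a ∈ lexAbove e D ↔ edeg a = D ∧ lexGT a e := by
  simp [lexAbove, edeg]

theorem card_lexAbove {n : ℕ} (e : Fin n →₀ ℕ) (D : ℕ) :
    (lexAbove e D).card = ∑ i, (lexGTAt e D i).card := by
  classical
  have : lexAbove e D = Finset.univ.biUnion (lexGTAt e D) := by
    ext a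
    simp [mem_lexAbove, mem_lexGTAt, lexGT]
  rw [this, Finset.card_biUnion]
  have key : ∀ i j : Fin n, i < j → Disjoint (lexGTAt e D i) (lexGTAt e D j) := by
    intro i j hij
    rw [Finset.disjoint_left]
    intro a hai haj
    have h1 := (mem_lexGTAt.mp hai).2.2
    have h2 := (mem_lexGTAt.mp haj).2.1 i hij
    omega
  intro i _ j _ hij
  rcases lt_or_gt_of_ne hij with h | h
  · exact key i j h
  · exact (key j i h).symm

/-- The exponent vector of the monomial `x₁^{d-n+1} x₂ ⋯ xₙ` of degree `d`. -/
def pivot (n d : ℕ) : Fin n →₀ ℕ :=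
  Finsupp.equivFunOnFinite.symm fun j => if (j : ℕ) = 0 then d + 1 - n else 1

theorem pivot_apply {n d : ℕ} (j : Fin n) :
    pivot n d j = if (j : ℕ) = 0 then d + 1 - n else 1 := rfl

theorem edeg_pivot {n d : ℕ} (hn : 1 ≤ n) (hd : n ≤ d + 1) : edeg (pivot n d) = d := by
  obtain ⟨k, rfl⟩ := Nat.exists_eq_add_of_le' hn
  simp [edeg, Fin.sum_univ_succ, pivot_apply]
  omega

theorem edeg_lexBump_pivot {n d : ℕ} (hn : 1 ≤ n) (hd : n ≤ d + 1) (i : Fin n) :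
    edeg (lexBump (pivot n d) i) + (n - 1 - i) = d + 1 := by
  have h : edeg (lexBump (pivot n d) i) + (Finset.Ioi i).card =
      edeg (pivot n d + Finsupp.single i 1) := by
    have hcard : (Finset.Ioi i).card = ∑ j, if i < j then 1 else 0 := by
      rw [Finset.sum_boole, Nat.cast_id]
      congr 1
      ext j
      simp
    rw [hcard, edeg, edeg, ← Finset.sum_add_distrib]
    refine Finset.sum_congr rfl fun j _ => ?_
    rw [lexBump_apply, Finsupp.add_apply]
    rcases lt_trichotomy j i with hj | rfl | hj
    · simp [hj, hj.not_gt, hj.ne]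
    · simp
    · have : (j : ℕ) ≠ 0 := by have := Fin.lt_def.mp hj; omega
      simp [hj, hj.not_gt, hj.ne', pivot_apply, this]
  rw [edeg_add, edeg_single, edeg_pivot hn hd, Fin.card_Ioi] at h
  omega

theorem choose_two_mul_eq {k : ℕ} (hk : 1 ≤ k) :
    (2 * k).choose k = 2 * (2 * k - 1).choose k := by
  obtain ⟨m, rfl⟩ := Nat.exists_eq_add_of_le' hk
  have : 2 * (m + 1) = (2 * m + 1) + 1 := by ring
  rw [this, Nat.choose_succ_succ, Nat.add_sub_cancel, ← Nat.choose_symm_half m]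
  ring

theorem xi_eq_sum_range (k : ℕ) :
    xi k = ∑ j ∈ Finset.range k, (2 * (j + 1) - 1).choose (j + 1) := by
  induction k with
  | zero => simp [xi]
  | succ k ih =>
    rw [Finset.sum_range_succ, ← ih, xi, xi, Finset.sum_Icc_succ_top (by omega)]

theorem card_lexAbove_pivot {n d : ℕ} (hn : 1 ≤ n) (hd : n ≤ d + 1) :
    (lexAbove (pivot n d) d).card = xi (n - 1) := by
  have h : ∀ i : Fin n, (lexGTAt (pivot n d) d i).card =
      if n - 1 - i = 0 then 0 else (2 * (n - 1 - (i : ℕ)) - 1).choose (n - 1 - i) := by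
    intro i
    have hb := edeg_lexBump_pivot hn hd i
    split_ifs with hi
    · exact card_lexGTAt_of_lt (by omega)
    · have := card_lexGTAt (m := n - 1 - i - 1) (pivot n d) i
      rw [show edeg (lexBump (pivot n d) i) + (n - 1 - i - 1) = d by omega] at this
      rw [this, ← Nat.choose_symm_of_eq_add]
      · congr 1; omega
      · omega
  rw [card_lexAbove, Finset.sum_congr rfl fun i _ => h i,
    Fin.sum_univ_eq_sum_range
      (fun i => if n - 1 - i = 0 then 0 else (2 * (n - 1 - i) - 1).choose (n - 1 - i)) n]
  obtain ⟨k, rfl⟩ := Nat.exists_eq_add_of_le' hn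
  rw [Finset.sum_range_reflect (fun j => if j = 0 then 0 else (2 * j - 1).choose j),
    Finset.sum_range_succ', Nat.add_sub_cancel, xi_eq_sum_range]
  simp

theorem card_lexAbove_pivot_succ {n d : ℕ} (hn : 1 ≤ n) (hd : n ≤ d + 1) :
    (lexAbove (pivot n d) (d + 1)).card = 2 * xi (n - 1) + 1 := by
  have h : ∀ i : Fin n, (lexGTAt (pivot n d) (d + 1) i).card =
      (2 * (n - 1 - (i : ℕ))).choose (n - 1 - i) := by
    intro i
    have hb := edeg_lexBump_pivot hn hd i
    have := card_lexGTAt (m := n - 1 - i) (pivot n d) i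
    rw [hb] at this
    rw [this]
    congr 1; omega
  rw [card_lexAbove, Finset.sum_congr rfl fun i _ => h i,
    Fin.sum_univ_eq_sum_range (fun i => (2 * (n - 1 - i)).choose (n - 1 - i)) n]
  obtain ⟨k, rfl⟩ := Nat.exists_eq_add_of_le' hn
  rw [Finset.sum_range_reflect (fun j => (2 * j).choose j), Finset.sum_range_succ',
    Nat.add_sub_cancel, xi_eq_sum_range, Finset.mul_sum]
  simp [choose_two_mul_eq]

theorem mem_expSet_span {K : Type} [Field K] {n : ℕ} {G : Set (Fin n →₀ ℕ)} {a : Fin n →₀ ℕ} :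
    a ∈ expSet (Ideal.span ((fun a => (monomial a (1 : K))) '' G)) ↔ ∃ g ∈ G, g ≤ a := by
  classical
  simp [expSet, mem_ideal_span_monomial_image, support_monomial]

theorem GenBy.exists_le {K : Type} [Field K] {n : ℕ} {I : Ideal (MvPolynomial (Fin n) K)}
    {P : (Fin n →₀ ℕ) → Prop} (h : GenBy I P) {a : Fin n →₀ ℕ} (ha : a ∈ expSet I) :
    ∃ g ∈ expSet I, P g ∧ g ≤ a := by
  obtain ⟨G, hG, rfl⟩ := h
  obtain ⟨g, hg, hga⟩ := mem_expSet_span.mp ha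
  exact ⟨g, mem_expSet_span.mpr ⟨g, hg, le_rfl⟩, hG g hg, hga⟩

theorem expSet_mono {K : Type} [Field K] {n : ℕ} {I : Ideal (MvPolynomial (Fin n) K)}
    {a b : Fin n →₀ ℕ} (ha : a ∈ expSet I) (hab : a ≤ b) : b ∈ expSet I := by
  obtain ⟨c, rfl⟩ := exists_add_of_le hab
  have := I.mul_mem_right (monomial c (1 : K)) ha
  rwa [monomial_mul, one_mul] at this

theorem GenBy.mu_le_card {K : Type} [Field K] {n : ℕ} {I : Ideal (MvPolynomial (Fin n) K)}
    {P : (Fin n →₀ ℕ) → Prop} (h : GenBy I P) (F : Finset (Fin n →₀ ℕ))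
    (hF : ∀ a ∈ expSet I, P a → a ∈ F) : mu I ≤ F.card := by
  classical
  obtain ⟨G, hG, rfl⟩ := h
  have hGF : G ⊆ F := fun a ha => hF a (mem_expSet_span.mpr ⟨a, ha, le_rfl⟩) (hG a ha)
  have hfin : G.Finite := F.finite_toSet.subset hGF
  refine le_trans (Nat.sInf_le ⟨hfin.toFinset.image fun a => monomial a (1 : K), rfl, ?_⟩) ?_
  · simp
  · exact Finset.card_image_le.trans (Finset.card_le_card (hfin.toFinset_subset.mpr hGF))

theorem pivot_mem_expSet {K : Type} [Field K] {n d : ℕ} (hn : 1 ≤ n)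
    {I : Ideal (MvPolynomial (Fin n) K)} (hlex : IsLexsegment I)
    (hgen : GenBy I (fun a => edeg a = d)) (hmu : xi (n - 1) < mu I) :
    n ≤ d + 1 ∧ pivot n d ∈ expSet I := by
  have hd : n ≤ d + 1 := by
    by_contra! hlt
    have h1 := hgen.mu_le_card (Finset.univ.finsuppAntidiag d)
      fun a _ ha => mem_finsuppAntidiag_univ.mpr ha
    rw [Finset.card_finsuppAntidiag_nat_eq_choose, Finset.card_univ, Fintype.card_fin] at h1
    obtain ⟨k, rfl⟩ := Nat.exists_eq_add_of_le' (show 2 ≤ n by omega)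
    have h2 : (k + 2 + d - 1).choose d ≤ (2 * (k + 1) - 1).choose (k + 1) := by
      rw [Nat.choose_symm_of_eq_add (show k + 2 + d - 1 = d + (k + 1) by omega)]
      exact Nat.choose_le_choose _ (by omega)
    have h3 : (2 * (k + 1) - 1).choose (k + 1) ≤ xi (k + 2 - 1) :=
      Finset.single_le_sum (f := fun j => (2 * j - 1).choose j) (fun _ _ => Nat.zero_le _)
        (Finset.mem_Icc.mpr ⟨by omega, by omega⟩)
    omega
  refine ⟨hd, ?_⟩
  by_contra hnot
  have := hgen.mu_le_card (lexAbove (pivot n d) d) fun a ha hda => by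
    refine mem_lexAbove.mpr ⟨hda, ?_⟩
    rcases lexGT_or_lexGT_of_ne (a := a) (b := pivot n d) (by rintro rfl; exact hnot ha) with h | h
    · exact h
    · exact absurd (hlex.2 a _ ha (by rw [edeg_pivot hn hd, hda]) h) hnot
  rw [card_lexAbove_pivot hn hd] at this
  omega

theorem HilbertDecompN.mul_card_le {K : Type} [Field K] {n d k : ℕ}
    {I : Ideal (MvPolynomial (Fin n) K)} (h : HilbertDecompN I k)
    (hgen : GenBy I (fun a => edeg a = d)) (F N : Finset (Fin n →₀ ℕ))
    (hF : ∀ a ∈ F, a ∈ expSet I ∧ edeg a = d)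
    (hN : ∀ a ∈ F, ∀ j, a + Finsupp.single j 1 ∈ N) : k * F.card ≤ N.card := by
  classical
  obtain ⟨ι, _, u, Z, hZ, hpart⟩ := h
  have hex : ∀ a ∈ F, ∃ i, u i = a := by
    intro a ha
    obtain ⟨haI, had⟩ := hF a ha
    obtain ⟨i, hi⟩ := (hpart a).1.mp haI
    have hu : u i ∈ expSet I := (hpart _).1.mpr ⟨i, fun _ => le_rfl, fun _ _ => rfl⟩
    obtain ⟨g, -, hgd, hg⟩ := hgen.exists_le hu
    refine ⟨i, eq_of_le_of_edeg_le hi.1 ?_⟩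
    have := edeg_le_of_le hg
    omega
  rcases F.eq_empty_or_nonempty with rfl | ⟨a₀, ha₀⟩
  · simp
  have : Nonempty ι := ⟨(hex a₀ ha₀).choose⟩
  choose! c hc using hex
  calc k * F.card = ∑ a ∈ F, k := by rw [Finset.sum_const, smul_eq_mul, mul_comm]
    _ ≤ ∑ a ∈ F, (Z (c a)).card := Finset.sum_le_sum fun a _ => hZ _
    _ = (F.sigma fun a => Z (c a)).card := (Finset.card_sigma _ _).symm
    _ ≤ N.card := by
      refine Finset.card_le_card_of_injOn (fun p => p.1 + Finsupp.single p.2 1) ?_ ?_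
      · rintro ⟨a, j⟩ hp
        exact hN a (Finset.mem_sigma.mp hp).1 j
      · have hcone : ∀ a ∈ F, ∀ j ∈ Z (c a),
            a + Finsupp.single j 1 ∈ cone (u (c a)) (Z (c a)) := by
          intro a ha j hj
          rw [hc a ha]
          refine ⟨fun l => by simp, fun l hl => ?_⟩
          have : l ≠ j := by rintro rfl; exact hl hj
          simp [this]
        rintro ⟨a, j⟩ hp ⟨b, l⟩ hq heq
        obtain ⟨ha, hj⟩ := Finset.mem_sigma.mp hp
        obtain ⟨hb, hl⟩ := Finset.mem_sigma.mp hq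
        dsimp only at ha hj hb hl heq
        have hab : c a = c b :=
          (hpart _).2 _ _ (hcone a ha j hj) (by rw [heq]; exact hcone b hb l hl)
        obtain rfl : a = b := by rw [← hc a ha, hab, hc b hb]
        have hjl := Finsupp.single_left_injective one_ne_zero (add_left_cancel heq)
        subst hjl
        rfl

theorem HilbertDecompN.le_one {K : Type} [Field K] {n d k : ℕ} (hn : 1 ≤ n)
    {I : Ideal (MvPolynomial (Fin n) K)} (hlex : IsLexsegment I)
    (hgen : GenBy I (fun a => edeg a = d)) (hmu : xi (n - 1) < mu I)
    (h : HilbertDecompN I k) : k ≤ 1 := by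
  classical
  obtain ⟨hd, he⟩ := pivot_mem_expSet hn hlex hgen hmu
  have hdeg := edeg_pivot hn hd
  have hnot : pivot n d ∉ lexAbove (pivot n d) d := by
    intro hmem
    obtain ⟨i, -, hi⟩ := (mem_lexAbove.mp hmem).2
    exact lt_irrefl _ hi
  have hcard := h.mul_card_le hgen (insert (pivot n d) (lexAbove (pivot n d) d))
    (lexAbove (pivot n d) (d + 1)) (fun a ha => by
      rcases Finset.mem_insert.mp ha with rfl | ha
      · exact ⟨he, hdeg⟩
      · obtain ⟨had, hgt⟩ := mem_lexAbove.mp ha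
        exact ⟨hlex.2 _ _ he (by rw [hdeg, had]) hgt, had⟩) (fun a ha j => by
      rw [mem_lexAbove, edeg_add, edeg_single]
      rcases Finset.mem_insert.mp ha with rfl | ha
      · exact ⟨by rw [hdeg], lexGT_add_single_self _ j⟩
      · obtain ⟨had, hgt⟩ := mem_lexAbove.mp ha
        exact ⟨by rw [had], hgt.add_single j⟩)
  rw [Finset.card_insert_of_notMem hnot, card_lexAbove_pivot hn hd,
    card_lexAbove_pivot_succ hn hd] at hcard
  by_contra! hk
  nlinarith

/-- The indices not smaller than any index in the support of `a`. -/
def tailVars {n : ℕ} (a : Fin n →₀ ℕ) : Finset (Fin n) :=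
  Finset.univ.filter fun j => ∀ l, a l ≠ 0 → l ≤ j

theorem mem_tailVars {n : ℕ} {a : Fin n →₀ ℕ} {j : Fin n} :
    j ∈ tailVars a ↔ ∀ l, a l ≠ 0 → l ≤ j := by
  simp [tailVars]

theorem eq_of_mem_cone_tailVars {n : ℕ} {u v a : Fin n →₀ ℕ} (huv : edeg u = edeg v)
    (hu : a ∈ cone u (tailVars u)) (hv : a ∈ cone v (tailVars v)) : u = v := by
  have key : ∀ u v : Fin n →₀ ℕ, edeg u = edeg v → a ∈ cone u (tailVars u) →
      a ∈ cone v (tailVars v) → ¬ lexGT u v := by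
    rintro u v huv hu hv ⟨i, heq, hlt⟩
    have hi : i ∈ tailVars v := by
      by_contra hc
      have h1 := hv.2 i hc
      have h2 := hu.1 i
      omega
    rw [mem_tailVars] at hi
    have hle : v ≤ u := by
      intro j
      rcases lt_trichotomy j i with hj | rfl | hj
      · exact (heq j hj).ge
      · exact hlt.le
      · by_contra! hc
        exact absurd (hi j (by omega)) (not_le.mpr hj)
    rw [eq_of_le_of_edeg_le hle huv.le] at hlt
    exact lt_irrefl _ hlt
  by_contra hne
  rcases lexGT_or_lexGT_of_ne hne with h | h
  · exact key u v huv hu hv h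
  · exact key v u huv.symm hv hu h

theorem exists_mem_cone_tailVars {K : Type} [Field K] {n d : ℕ}
    {I : Ideal (MvPolynomial (Fin n) K)} (hlex : IsLexsegment I)
    (hgen : GenBy I (fun a => edeg a = d)) (k : ℕ) :
    ∀ a ∈ expSet I, edeg a = d + k →
      ∃ g ∈ expSet I, edeg g = d ∧ a ∈ cone g (tailVars g) := by
  induction k with
  | zero => exact fun a ha had => ⟨a, ha, had, fun _ => le_rfl, fun _ _ => rfl⟩
  | succ k ih =>
    intro a ha had
    have hne : a.support.Nonempty := by
      rw [Finsupp.support_nonempty_iff]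
      rintro rfl
      simp [edeg] at had
    obtain ⟨m, hm, hmax⟩ := a.support.exists_max_image id hne
    have hm0 : a m ≠ 0 := Finsupp.mem_support_iff.mp hm
    obtain ⟨b, rfl⟩ : ∃ b, a = b + Finsupp.single m 1 := by
      refine ⟨a - Finsupp.single m 1, (tsub_add_cancel_of_le ?_).symm⟩
      rw [Finsupp.single_le_iff]
      omega
    rw [edeg_add, edeg_single] at had
    have hbmax : ∀ l, b l ≠ 0 → l ≤ m := fun l hl => hmax l (by simp [hl])
    have hb : b ∈ expSet I := by
      obtain ⟨g, hg, hgd, hgb⟩ := hgen.exists_le ha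
      by_cases hgm : g ≤ b
      · exact expSet_mono hg hgm
      obtain ⟨i, hi⟩ : ∃ i, g i < b i := by
        by_contra! hc
        obtain rfl : b = g := eq_of_le_of_edeg_le hc (by omega)
        exact hgm le_rfl
      have hgm' : g m = b m + 1 := by
        by_contra hc
        refine hgm fun l => ?_
        have := hgb l
        rcases eq_or_ne l m with rfl | hl
        · simp at this; omega
        · simpa [hl] using this
      have him : i < m := lt_of_le_of_ne (hbmax i (by omega)) (by rintro rfl; omega)
      obtain ⟨h, rfl⟩ : ∃ h, g = h + Finsupp.single m 1 := by
        refine ⟨g - Finsupp.single m 1, (tsub_add_cancel_of_le ?_).symm⟩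
        rw [Finsupp.single_le_iff]
        omega
      refine expSet_mono (a := h + Finsupp.single i 1) (hlex.2 _ _ hg ?_ ?_) ?_
      · simp only [edeg_add, edeg_single]
      · refine ⟨i, fun j hj => ?_, ?_⟩
        · simp [hj.ne, (hj.trans him).ne]
        · simp [him.ne]
      · intro l
        have := hgb l
        rcases eq_or_ne l i with rfl | hl
        · simp [him.ne] at hi ⊢
          omega
        · simpa [hl] using this
    obtain ⟨g, hg, hgd, hbg⟩ := ih b hb (by omega)
    refine ⟨g, hg, hgd, fun l => (hbg.1 l).trans (by simp), fun l hl => ?_⟩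
    have hlm : l ≠ m := by
      rintro rfl
      refine hl (mem_tailVars.mpr fun j hj => hbmax j ?_)
      have := hbg.1 j
      omega
    simp [hlm, hbg.2 l hl]

theorem hilbertDecompN_one {K : Type} [Field K] {n d : ℕ} (hn : 1 ≤ n)
    {I : Ideal (MvPolynomial (Fin n) K)} (hlex : IsLexsegment I)
    (hgen : GenBy I (fun a => edeg a = d)) : HilbertDecompN I 1 := by
  have hfin : {a | a ∈ expSet I ∧ edeg a = d}.Finite :=
    (Finset.univ.finsuppAntidiag d).finite_toSet.subset
      fun a ha => mem_finsuppAntidiag_univ.mpr ha.2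
  refine ⟨{a | a ∈ expSet I ∧ edeg a = d}, hfin.fintype, fun a => a, fun a => tailVars a.1,
    fun a => ?_, fun a => ⟨⟨fun ha => ?_, ?_⟩, fun g g' hg hg' => ?_⟩⟩
  · refine Finset.card_pos.mpr ⟨⟨n - 1, by omega⟩, mem_tailVars.mpr fun l _ => ?_⟩
    rw [Fin.le_def]
    have := l.isLt
    simp only
    omega
  · obtain ⟨g, -, hgd, hga⟩ := hgen.exists_le ha
    have := edeg_le_of_le hga
    obtain ⟨g, hg, hgd, hag⟩ :=
      exists_mem_cone_tailVars hlex hgen (edeg a - d) a ha (by omega)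
    exact ⟨⟨g, hg, hgd⟩, hag⟩
  · rintro ⟨g, hg⟩
    exact expSet_mono g.2.1 hg.1
  · exact Subtype.ext (eq_of_mem_cone_tailVars (g.2.2.trans g'.2.2.symm) hg hg')

/-- Theorem `hdepth_lex`(b). Let `I ⊂ S = K[x_1,…,x_n]` be a nonzero
lexsegment ideal generated by monomials of degree `d`. If `μ(I) > ξ_{n-1}`, then in the
multigraded case `hdepth_n(I) = 1`. -/
theorem lexsegment_hdepthN_eq_one {K : Type} [Field K] {n d : ℕ} (hn : 1 ≤ n)
    (I : Ideal (MvPolynomial (Fin n) K)) (hI : I ≠ ⊥) (hlex : IsLexsegment I)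
    (hgen : GenBy I (fun a => edeg a = d)) (hmu : xi (n - 1) < mu I) :
    hdepthN I = 1 := by
  refine le_antisymm (sSup_le ?_) (le_sSup ⟨1, hilbertDecompN_one hn hlex hgen, by simp⟩)
  rintro _ ⟨m, hm, rfl⟩
  exact_mod_cast hm.le_one hn hlex hgen hmu
end
end

section
/- Let J ⊊ I be squarefree monomial ideals of S = K[x_1,…,x_n], generated by monomials of degrees ≥ d and ≥ d+1 respectively, and let ρ_j(I∖J) be the number of squarefree monomials of degree j in I∖J. Assume depth_S(I/J) ≥ t, where t is an integer with d ≤ t < n. If for some k with d+1 ≤ k ≤ t+1 one has ρ_k(I∖J) < Σ_{j=d}^{k−1} (−1)^{k−j+1} C(t+1−j, k−j) ρ_j(I∖J), then depth_S(I/J) = t, independently of the characteristic of K. -/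
noncomputable section

open MvPolynomial

open MvPolynomial

section GenericLinearForm

open RingTheory.Sequence CategoryTheory Abelian Pointwise

lemma X_mem_maxIdeal {F : Type} [Field F] {n : ℕ} (i : Fin n) :
    (X i : MvPolynomial (Fin n) F) ∈ maxIdeal F n :=
  Ideal.subset_span ⟨i, rfl⟩

/-- Over an infinite field, if the graded maximal ideal contains an `N`-regular element, then some
linear form is `N`-regular. -/
lemma exists_linearForm_isSMulRegular {F : Type} [Field F] [Infinite F] {n : ℕ} {N : Type}
    [AddCommGroup N] [Module (MvPolynomial (Fin n) F) N] [Module.Finite (MvPolynomial (Fin n) F) N]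
    {f : MvPolynomial (Fin n) F} (hf : f ∈ maxIdeal F n) (hreg : IsSMulRegular N f) :
    ∃ c : Fin n → F, IsSMulRegular N (∑ i, c i • X i : MvPolynomial (Fin n) F) := by
  let S := MvPolynomial (Fin n) F
  let L : (Fin n → F) →ₗ[F] S := Fintype.linearCombination F X
  have hL (c : Fin n → F) : L c = ∑ i, c i • X i := Fintype.linearCombination_apply ..
  have := (associatedPrimes.finite S N).to_subtype
  let p : associatedPrimes S N → Submodule F (Fin n → F) :=
    fun P => (P.1.restrictScalars F).comap L
  by_cases hcov : ⋃ P, (p P : Set (Fin n → F)) = Set.univ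
  · obtain ⟨P, hP⟩ := Subspace.exists_eq_top_of_iUnion_eq_univ hcov
    have hX (i : Fin n) : (X i : S) ∈ P.1 := by
      have : Pi.single i 1 ∈ p P := hP ▸ Submodule.mem_top
      simpa [p, L] using this
    have hfP : f ∈ P.1 := Ideal.span_le.mpr (Set.range_subset_iff.mpr hX) hf
    have hzero : f ∈ {r : S | ∃ x : N, x ≠ 0 ∧ r • x = 0} := by
      rw [← biUnion_associatedPrimes_eq_zero_divisors]
      exact Set.mem_biUnion P.2 hfP
    obtain ⟨x, hx, hfx⟩ := hzero
    exact absurd (hreg (by simpa using hfx)) hx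
  · obtain ⟨c, hc⟩ := (Set.ne_univ_iff_exists_notMem _).mp hcov
    refine ⟨c, isSMulRegular_iff_right_eq_zero_of_smul.mpr fun x hx => by_contra fun hx0 => ?_⟩
    have hmem : L c ∈ ⋃ P ∈ associatedPrimes S N, (P : Set S) := by
      rw [biUnion_associatedPrimes_eq_zero_divisors]
      exact ⟨x, hx0, by rw [hL]; exact hx⟩
    obtain ⟨P, hP, hcP⟩ := Set.mem_iUnion₂.mp hmem
    exact hc (Set.mem_iUnion.mpr ⟨⟨P, hP⟩, hcP⟩)

/-- Dividing out an arbitrary `N`-regular element of `I` shortens the `N`-regular sequences in `I`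
by one. -/
lemma exists_isRegular_quotSMulTop {R : Type} [CommRing R] [IsNoetherianRing R] {I : Ideal R}
    {N : Type} [AddCommGroup N] [Module R N] [Module.Finite R N]
    (hI : I • (⊤ : Submodule R N) < ⊤) {r : ℕ}
    (hN : ∃ rs : List R, rs.length = r + 1 ∧ (∀ f ∈ rs, f ∈ I) ∧ IsRegular N rs)
    {x : R} (hxI : x ∈ I) (hx : IsSMulRegular N x) :
    ∃ rs : List R, rs.length = r ∧ (∀ f ∈ rs, f ∈ I) ∧ IsRegular (QuotSMulTop x N) rs := by
  have hI' : I • (⊤ : Submodule R (QuotSMulTop x N)) < ⊤ := by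
    refine lt_top_iff_ne_top.mpr fun eq => hI.ne ?_
    have := congrArg (Submodule.comap (Submodule.mkQ _)) eq
    simpa [Submodule.comap_smul_top_of_surjective I _ (Submodule.mkQ_surjective _),
      Submodule.smul_mono_left ((Ideal.span_singleton_le_iff_mem I).mpr hxI),
      ← Submodule.ideal_span_singleton_smul] using this
  have hsupp : Module.support R (R ⧸ I) = PrimeSpectrum.zeroLocus I := by
    rw [Module.support_eq_zeroLocus, Ideal.annihilator_quotient]
  obtain ⟨rs, hlen, hmem, hrs⟩ := hN
  have hext := ModuleCat.subsingleton_ext_of_exists_isRegular I (ModuleCat.of R (R ⧸ I)) hsupp.subset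
    (ModuleCat.of R N) hI rs hmem hrs
  rw [hlen] at hext
  refine ModuleCat.exists_isRegular_of_exists_subsingleton_ext I r
    (ModuleCat.of R (QuotSMulTop x N)) hI' (ModuleCat.of R (R ⧸ I)) hsupp fun i hi => ?_
  have zero1 := AddCommGrpCat.isZero_of_iff_subsingleton.mpr (hext i (by omega))
  have zero2 := AddCommGrpCat.isZero_of_iff_subsingleton.mpr (hext (i + 1) (by omega))
  exact AddCommGrpCat.subsingleton_of_isZero <| ShortComplex.Exact.isZero_of_both_zeros
    ((Ext.covariant_sequence_exact₃' _
      (IsSMulRegular.smulShortComplex_shortExact (M := ModuleCat.of R N) hx)) i (i + 1) rfl)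
    (zero1.eq_zero_of_src _) (zero2.eq_zero_of_tgt _)

/-- If `I` contains a weakly `N`-regular sequence and `I N ≠ N`, then the sequence is regular. -/
lemma isRegular_of_isWeaklyRegular_of_smul_lt {R : Type} [CommRing R] {I : Ideal R} {N : Type}
    [AddCommGroup N] [Module R N] (hI : I • (⊤ : Submodule R N) < ⊤) {rs : List R}
    (hmem : ∀ f ∈ rs, f ∈ I) (h : IsWeaklyRegular N rs) : IsRegular N rs := by
  have hle : Ideal.ofList rs ≤ I := Ideal.span_le.mpr hmem
  exact ⟨h, fun eq => hI.not_ge (eq.le.trans (Submodule.smul_mono_left hle))⟩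

end GenericLinearForm

section HilbertSeries

open RingTheory.Sequence Pointwise

/-- A family of projections of `N` onto graded pieces: the variables shift the degree by one. -/
structure GradedProj (F : Type) [Field F] (n : ℕ) (N : Type) [AddCommGroup N]
    [Module (MvPolynomial (Fin n) F) N] [Module F N] where
  proj : ℕ → N →ₗ[F] N
  proj_proj : ∀ k v, proj k (proj k v) = proj k v
  proj_X_smul : ∀ i k v, proj (k + 1) ((X i : MvPolynomial (Fin n) F) • v) =
    (X i : MvPolynomial (Fin n) F) • proj k v
  proj_zero_X_smul : ∀ i v, proj 0 ((X i : MvPolynomial (Fin n) F) • v) = 0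
  finite : ∀ k, FiniteDimensional F (LinearMap.range (proj k))

namespace GradedProj

variable {F : Type} [Field F] {n : ℕ} {N : Type} [AddCommGroup N]
  [Module (MvPolynomial (Fin n) F) N] [Module F N]

/-- The Hilbert series of a graded module. -/
def series (π : GradedProj F n N) : PowerSeries ℤ :=
  PowerSeries.mk fun k => (Module.finrank F (LinearMap.range (π.proj k)) : ℤ)

lemma series_eq_zero [IsScalarTower F (MvPolynomial (Fin n) F) N] (π : GradedProj F n N)
    (h : maxIdeal F n • (⊤ : Submodule (MvPolynomial (Fin n) F) N) = ⊤) : π.series = 0 := by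
  have hmem (v : N) : v ∈ Submodule.span (MvPolynomial (Fin n) F)
      (Set.range (X : Fin n → MvPolynomial (Fin n) F) • (Set.univ : Set N)) := by
    have : v ∈ (⊤ : Submodule (MvPolynomial (Fin n) F) N) := Submodule.mem_top
    rwa [← h, maxIdeal, ← Submodule.span_univ, Submodule.span_smul_span] at this
  have hrep (v : N) : ∃ w : Fin n → N, v = ∑ i, (X i : MvPolynomial (Fin n) F) • w i := by
    induction hmem v using Submodule.span_induction with
    | mem x hx =>
      obtain ⟨_, ⟨i, rfl⟩, y, -, rfl⟩ := hx
      refine ⟨Pi.single i y, ?_⟩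
      rw [Finset.sum_eq_single i] <;> simp +contextual
    | zero => exact ⟨0, by simp⟩
    | add x y _ _ hx hy =>
      obtain ⟨a, rfl⟩ := hx
      obtain ⟨b, rfl⟩ := hy
      exact ⟨a + b, by simp [Finset.sum_add_distrib]⟩
    | smul c x _ hx =>
      obtain ⟨a, rfl⟩ := hx
      exact ⟨c • a, by simp [Finset.smul_sum, smul_comm c]⟩
  have hproj (k : ℕ) : π.proj k = 0 := by
    induction k with
    | zero =>
      ext v
      obtain ⟨w, rfl⟩ := hrep v
      simp [π.proj_zero_X_smul]
    | succ k ih =>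
      ext v
      obtain ⟨w, rfl⟩ := hrep v
      simp [π.proj_X_smul, ih]
  ext k
  have hbot : LinearMap.range (π.proj k) = ⊥ := by rw [hproj, LinearMap.range_zero]
  rw [series, PowerSeries.coeff_mk, hbot, finrank_bot]
  simp

variable [IsScalarTower F (MvPolynomial (Fin n) F) N]

lemma proj_linearForm_smul (π : GradedProj F n N) (c : Fin n → F) (k : ℕ) (v : N) :
    π.proj (k + 1) ((∑ i, c i • X i : MvPolynomial (Fin n) F) • v) =
      (∑ i, c i • X i : MvPolynomial (Fin n) F) • π.proj k v := by
  simp [Finset.sum_smul, smul_assoc, π.proj_X_smul]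

lemma proj_zero_linearForm_smul (π : GradedProj F n N) (c : Fin n → F) (v : N) :
    π.proj 0 ((∑ i, c i • X i : MvPolynomial (Fin n) F) • v) = 0 := by
  simp [Finset.sum_smul, smul_assoc, π.proj_zero_X_smul]

/-- Dividing out a regular linear form multiplies the Hilbert series by `1 - T`. -/
lemma exists_of_ker_eq_smul (π : GradedProj F n N) (c : Fin n → F)
    (hc : IsSMulRegular N (∑ i, c i • X i : MvPolynomial (Fin n) F)) {Q : Type} [AddCommGroup Q]
    [Module (MvPolynomial (Fin n) F) Q] [Module F Q] [IsScalarTower F (MvPolynomial (Fin n) F) Q]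
    (q : N →ₗ[MvPolynomial (Fin n) F] Q) (hq : Function.Surjective q)
    (hker : ∀ v, q v = 0 ↔ ∃ w, (∑ i, c i • X i : MvPolynomial (Fin n) F) • w = v) :
    ∃ π' : GradedProj F n Q, π'.series = (1 - PowerSeries.X) * π.series := by
  set ℓ : MvPolynomial (Fin n) F := ∑ i, c i • X i
  let qF : N →ₗ[F] Q := q.restrictScalars F
  replace hq : Function.Surjective qF := hq
  replace hker (v : N) : qF v = 0 ↔ ∃ w, ℓ • w = v := hker v
  have hle (k : ℕ) : LinearMap.ker qF ≤ LinearMap.ker (qF ∘ₗ π.proj k) := by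
    intro v hv
    obtain ⟨w, rfl⟩ := (hker v).mp hv
    cases k with
    | zero => simp [ℓ, π.proj_zero_linearForm_smul]
    | succ k =>
      simp only [LinearMap.mem_ker, LinearMap.comp_apply, hker]
      exact ⟨_, (π.proj_linearForm_smul c k w).symm⟩
  let proj' (k : ℕ) : Q →ₗ[F] Q :=
    (LinearMap.ker qF).liftQ (qF ∘ₗ π.proj k) (hle k) ∘ₗ
      (qF.quotKerEquivOfSurjective hq).symm.toLinearMap
  have hproj' (k : ℕ) (v : N) : proj' k (qF v) = qF (π.proj k v) := by
    have : (qF.quotKerEquivOfSurjective hq).symm (qF v) = Submodule.Quotient.mk v := by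
      rw [LinearEquiv.symm_apply_eq]
      rfl
    simp [proj', this]
  have hrange (k : ℕ) :
      LinearMap.range (proj' k) = LinearMap.range (qF.domRestrict (LinearMap.range (π.proj k))) := by
    ext v
    constructor
    · rintro ⟨w, rfl⟩
      obtain ⟨w, rfl⟩ := hq w
      exact ⟨⟨π.proj k w, w, rfl⟩, (hproj' k w).symm⟩
    · rintro ⟨⟨_, w, rfl⟩, rfl⟩
      exact ⟨qF w, hproj' k w⟩
  have hsmul (f : MvPolynomial (Fin n) F) (v : N) : f • qF v = qF (f • v) := (map_smul q f v).symm
  have hfin (k : ℕ) : FiniteDimensional F (LinearMap.range (proj' k)) := by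
    have := π.finite k
    rw [hrange]
    infer_instance
  refine ⟨⟨proj', fun k v => ?_, fun i k v => ?_, fun i v => ?_, hfin⟩, ?_⟩
  · obtain ⟨v, rfl⟩ := hq v
    simp only [hproj', π.proj_proj]
  · obtain ⟨v, rfl⟩ := hq v
    simp only [hproj', hsmul, π.proj_X_smul]
  · obtain ⟨v, rfl⟩ := hq v
    simp only [hproj', hsmul, π.proj_zero_X_smul, map_zero]
  · let mulℓ : N →ₗ[F] N := (LinearMap.lsmul (MvPolynomial (Fin n) F) N ℓ).restrictScalars F
    have hinj : Function.Injective mulℓ := hc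
    have hdim (k : ℕ) : Module.finrank F (LinearMap.range (proj' k)) +
        Module.finrank F (LinearMap.range (π.proj k) ⊓ LinearMap.ker qF : Submodule F N) =
          Module.finrank F (LinearMap.range (π.proj k)) := by
      have := π.finite k
      rw [hrange, ← LinearMap.finrank_range_add_finrank_ker
        (qF.domRestrict (LinearMap.range (π.proj k))), LinearMap.ker_domRestrict,
        ← Submodule.finrank_map_subtype_eq, Submodule.map_comap_subtype]
    have hinf0 : LinearMap.range (π.proj 0) ⊓ LinearMap.ker qF = ⊥ := by
      rw [eq_bot_iff]
      rintro _ ⟨⟨v, rfl⟩, hv⟩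
      obtain ⟨w, hw⟩ := (hker _).mp hv
      rw [Submodule.mem_bot, ← π.proj_proj, ← hw, π.proj_zero_linearForm_smul]
    have hinf (k : ℕ) : LinearMap.range (π.proj (k + 1)) ⊓ LinearMap.ker qF =
        (LinearMap.range (π.proj k)).map mulℓ := by
      apply le_antisymm
      · rintro _ ⟨⟨v, rfl⟩, hv⟩
        obtain ⟨w, hw⟩ := (hker _).mp hv
        refine ⟨π.proj k w, ⟨w, rfl⟩, ?_⟩
        rw [← π.proj_proj (k + 1) v, ← hw, π.proj_linearForm_smul]
        rfl
      · rintro _ ⟨_, ⟨w, rfl⟩, rfl⟩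
        refine ⟨⟨ℓ • w, π.proj_linearForm_smul c k w⟩, (hker _).mpr ⟨_, rfl⟩⟩
    ext k
    rw [sub_mul, one_mul, map_sub]
    cases k with
    | zero =>
      have := hdim 0
      rw [hinf0, finrank_bot] at this
      simp [series, ← this]
    | succ k =>
      have h := hdim (k + 1)
      rw [hinf, ← (Submodule.equivMapOfInjective mulℓ hinj _).finrank_eq] at h
      simp only [series, PowerSeries.coeff_mk, PowerSeries.coeff_succ_X_mul, ← h]
      push_cast
      ring

lemma exists_quotSMulTop (π : GradedProj F n N) (c : Fin n → F)
    (hc : IsSMulRegular N (∑ i, c i • X i : MvPolynomial (Fin n) F)) :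
    ∃ π' : GradedProj F n (QuotSMulTop (∑ i, c i • X i : MvPolynomial (Fin n) F) N),
      π'.series = (1 - PowerSeries.X) * π.series := by
  refine π.exists_of_ker_eq_smul c hc (Submodule.mkQ _) (Submodule.mkQ_surjective _) fun v => ?_
  rw [Submodule.mkQ_apply, Submodule.Quotient.mk_eq_zero, Submodule.mem_smul_pointwise_iff_exists]
  simp

/-- If the graded maximal ideal contains a weakly `N`-regular sequence of length `r`, then
`(1 - T) ^ r` times the Hilbert series of `N` has nonnegative coefficients. -/
theorem coeff_one_sub_pow_mul_series_nonneg [Infinite F] (r : ℕ) :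
    ∀ {N : Type} [AddCommGroup N] [Module (MvPolynomial (Fin n) F) N] [Module F N]
      [IsScalarTower F (MvPolynomial (Fin n) F) N] [Module.Finite (MvPolynomial (Fin n) F) N]
      (π : GradedProj F n N) {rs : List (MvPolynomial (Fin n) F)}, rs.length = r →
      (∀ f ∈ rs, f ∈ maxIdeal F n) → IsWeaklyRegular N rs → ∀ k,
      0 ≤ PowerSeries.coeff k ((1 - PowerSeries.X) ^ r * π.series) := by
  induction r with
  | zero =>
    intro N _ _ _ _ _ π rs _ _ _ k
    simp [series]
  | succ r ih =>
    intro N _ _ _ _ _ π rs hlen hmem hreg k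
    rcases (le_top (a := maxIdeal F n •
      (⊤ : Submodule (MvPolynomial (Fin n) F) N))).eq_or_lt with h | h
    · simp [π.series_eq_zero h]
    · have hrs := isRegular_of_isWeaklyRegular_of_smul_lt h hmem hreg
      obtain ⟨c, hc⟩ : ∃ c : Fin n → F,
          IsSMulRegular N (∑ i, c i • X i : MvPolynomial (Fin n) F) := by
        cases rs with
        | nil => simp at hlen
        | cons f rs =>
          exact exists_linearForm_isSMulRegular (hmem f (by simp))
            ((isWeaklyRegular_cons_iff N f rs).mp hreg).1
      have hcmem : (∑ i, c i • X i : MvPolynomial (Fin n) F) ∈ maxIdeal F n :=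
        Ideal.sum_mem _ fun i _ => Submodule.smul_of_tower_mem _ _ (X_mem_maxIdeal i)
      obtain ⟨rs', hlen', hmem', hreg'⟩ :=
        exists_isRegular_quotSMulTop h ⟨rs, hlen, hmem, hrs⟩ hcmem hc
      obtain ⟨π', hπ'⟩ := π.exists_quotSMulTop c hc
      rw [pow_succ, mul_assoc, ← hπ']
      exact ih π' hlen' hmem' hreg'.toIsWeaklyRegular k

end GradedProj

end HilbertSeries

section GradedBasis

open RingTheory.Sequence TensorProduct

variable {F : Type} [Field F] {n : ℕ} {N : Type} [AddCommGroup N]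
  [Module (MvPolynomial (Fin n) F) N] [Module F N]

/-- A basis is homogeneous for `deg` if multiplication by a variable sends each basis vector to
zero or to a basis vector of the next degree. -/
def IsHomogeneousBasis {ι : Type} (b : Module.Basis ι F N) (deg : ι → ℕ) : Prop :=
  ∀ (i : Fin n) a, (X i : MvPolynomial (Fin n) F) • b a = 0 ∨
    ∃ a', (X i : MvPolynomial (Fin n) F) • b a = b a' ∧ deg a' = deg a + 1

lemma IsHomogeneousBasis.exists_gradedProj [IsScalarTower F (MvPolynomial (Fin n) F) N] {ι : Type}
    {b : Module.Basis ι F N} {deg : ι → ℕ} (hb : IsHomogeneousBasis (n := n) b deg)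
    (hfin : ∀ k, {a | deg a = k}.Finite) :
    ∃ π : GradedProj F n N, π.series = PowerSeries.mk fun k => ({a | deg a = k}.ncard : ℤ) := by
  classical
  let proj (k : ℕ) : N →ₗ[F] N := b.constr F fun a => if deg a = k then b a else 0
  have hproj (k : ℕ) (a : ι) : proj k (b a) = if deg a = k then b a else 0 :=
    b.constr_basis F _ a
  have hrange (k : ℕ) : LinearMap.range (proj k) = Submodule.span F (b '' {a | deg a = k}) := by
    apply le_antisymm
    · rw [LinearMap.range_eq_map, ← b.span_eq, Submodule.map_span, Submodule.span_le]
      rintro _ ⟨_, ⟨a, rfl⟩, rfl⟩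
      rw [hproj]
      split_ifs with h
      · exact Submodule.subset_span ⟨a, h, rfl⟩
      · exact Submodule.zero_mem _
    · rw [Submodule.span_le]
      rintro _ ⟨a, rfl, rfl⟩
      exact ⟨b a, by rw [hproj, if_pos rfl]⟩
  let mulX (i : Fin n) : N →ₗ[F] N :=
    (LinearMap.lsmul (MvPolynomial (Fin n) F) N (X i)).restrictScalars F
  have hidem (k : ℕ) : proj k ∘ₗ proj k = proj k := by
    refine b.ext fun a => ?_
    by_cases h : deg a = k <;> simp [hproj, h]
  have hmul (i : Fin n) (k : ℕ) : proj (k + 1) ∘ₗ mulX i = mulX i ∘ₗ proj k := by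
    refine b.ext fun a => ?_
    change proj (k + 1) ((X i : MvPolynomial (Fin n) F) • b a) =
      (X i : MvPolynomial (Fin n) F) • proj k (b a)
    rcases hb i a with h | ⟨a', h, hdeg⟩
    · rw [h, hproj]
      split_ifs <;> simp [h]
    · rw [h, hproj, hproj, hdeg]
      split_ifs <;> first | omega | simp [h]
  have hmul0 (i : Fin n) : proj 0 ∘ₗ mulX i = 0 := by
    refine b.ext fun a => ?_
    change proj 0 ((X i : MvPolynomial (Fin n) F) • b a) = 0
    rcases hb i a with h | ⟨a', h, hdeg⟩
    · rw [h, map_zero]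
    · rw [h, hproj, if_neg (by omega)]
  refine ⟨⟨proj, fun k => LinearMap.congr_fun (hidem k), fun i k => LinearMap.congr_fun (hmul i k),
    fun i => LinearMap.congr_fun (hmul0 i), fun k => ?_⟩, ?_⟩
  · rw [hrange]
    exact FiniteDimensional.span_of_finite F ((hfin k).image b)
  · ext k
    rw [GradedProj.series, PowerSeries.coeff_mk, PowerSeries.coeff_mk]
    simp only
    have := (hfin k).fintype
    have hli : LinearIndependent F fun a : {a | deg a = k} => b a.1 :=
      b.linearIndependent.comp _ Subtype.val_injective
    rw [hrange, Set.image_eq_range, finrank_span_eq_card hli, Set.ncard_eq_toFinset_card',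
      Set.toFinset_card]

attribute [local instance] MvPolynomial.algebraMvPolynomial

/-- If the graded maximal ideal contains a weakly `N`-regular sequence of length `r`, then
`(1 - T) ^ r` times the Hilbert series of `N` has nonnegative coefficients. -/
theorem IsHomogeneousBasis.coeff_one_sub_pow_mul_nonneg [IsScalarTower F (MvPolynomial (Fin n) F) N]
    [Module.Finite (MvPolynomial (Fin n) F) N] {ι : Type}
    {b : Module.Basis ι F N} {deg : ι → ℕ} (hb : IsHomogeneousBasis (n := n) b deg)
    (hfin : ∀ k, {a | deg a = k}.Finite) {rs : List (MvPolynomial (Fin n) F)}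
    (hmem : ∀ f ∈ rs, f ∈ maxIdeal F n) (hreg : IsWeaklyRegular N rs) (k : ℕ) :
    0 ≤ PowerSeries.coeff k ((1 - PowerSeries.X) ^ rs.length *
      PowerSeries.mk fun k => ({a | deg a = k}.ncard : ℤ)) := by
  let E := AlgebraicClosure F
  have : Infinite E := IsAlgClosed.instInfinite
  let S := MvPolynomial (Fin n) F
  let T := MvPolynomial (Fin n) E
  let e : T ⊗[S] N ≃ₗ[E] E ⊗[F] N := Algebra.IsPushout.cancelBaseChange F E S T N
  let bE : Module.Basis ι E (T ⊗[S] N) := (b.baseChange E).map e.symm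
  have hbE_apply (a : ι) : bE a = 1 ⊗ₜ b a := by
    simp [bE, e, Module.Basis.baseChange_apply]
  have hbE : IsHomogeneousBasis (n := n) bE deg := by
    intro i a
    have hX : (X i : T) • bE a = 1 ⊗ₜ ((X i : S) • b a) := by
      have : (X i : T) = algebraMap S T (X i) := (map_X _ i).symm
      rw [hbE_apply, this, algebraMap_smul, TensorProduct.tmul_smul]
    rcases hb i a with h | ⟨a', h, hdeg⟩
    · exact .inl (by rw [hX, h, TensorProduct.tmul_zero])
    · exact .inr ⟨a', by rw [hX, h, hbE_apply], hdeg⟩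
  obtain ⟨π, hπ⟩ := hbE.exists_gradedProj hfin
  have : Module.Flat S T := Module.Flat.of_linearEquiv
    (Algebra.IsPushout.equiv F S E T).symm.toLinearEquiv
  have hregT := hreg.of_flat_of_isBaseChange (TensorProduct.isBaseChange S N T)
  rw [← hπ]
  refine π.coeff_one_sub_pow_mul_series_nonneg rs.length (by simp) (fun f hf => ?_) hregT k
  obtain ⟨g, hg, rfl⟩ := List.mem_map.mp hf
  have hle : maxIdeal F n ≤ (maxIdeal E n).comap (algebraMap S T) := by
    refine Ideal.span_le.mpr ?_
    rintro _ ⟨i, rfl⟩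
    have hX : algebraMap S T (X i) = X i := map_X _ i
    rw [SetLike.mem_coe, Ideal.mem_comap, hX]
    exact X_mem_maxIdeal i
  exact hle (hmem g hg)

end GradedBasis

section MonomialQuotient

variable {K : Type} [Field K] {n : ℕ} {I J : Ideal (MvPolynomial (Fin n) K)}

lemma mem_expSet {a : Fin n →₀ ℕ} : a ∈ expSet I ↔ monomial a (1 : K) ∈ I := Iff.rfl

lemma GenBy.mem_iff {P : (Fin n →₀ ℕ) → Prop} (h : GenBy I P) {p : MvPolynomial (Fin n) K} :
    p ∈ I ↔ ∀ a ∈ p.support, a ∈ expSet I := by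
  obtain ⟨G, -, rfl⟩ := h
  simp [expSet, mem_ideal_span_monomial_image]

lemma GenBy.mem_expSet_iff {P : (Fin n →₀ ℕ) → Prop} (h : GenBy I P) :
    ∃ G : Set (Fin n →₀ ℕ), (∀ g ∈ G, P g) ∧ ∀ a, a ∈ expSet I ↔ ∃ g ∈ G, g ≤ a := by
  obtain ⟨G, hG, rfl⟩ := h
  exact ⟨G, hG, by simp [expSet, mem_ideal_span_monomial_image]⟩

lemma edeg_add_single (a : Fin n →₀ ℕ) (i : Fin n) : edeg (a + Finsupp.single i 1) = edeg a + 1 := by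
  simp [edeg, Finset.sum_add_distrib, Finsupp.single_apply]

lemma finite_edeg_eq (k : ℕ) : {a : Fin n →₀ ℕ | edeg a = k}.Finite := by
  refine (Set.finite_Iic (Finsupp.equivFunOnFinite.symm fun _ => k)).subset fun a ha i => ?_
  rw [← show edeg a = k from ha]
  exact Finset.single_le_sum (f := a) (fun _ _ => Nat.zero_le _) (Finset.mem_univ i)

/-- The residue class of a monomial of `I` modulo `J`. -/
def monomialClass (I J : Ideal (MvPolynomial (Fin n) K)) {a : Fin n →₀ ℕ} (ha : a ∈ expSet I) :
    I ⧸ Submodule.comap I.subtype J :=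
  Submodule.Quotient.mk ⟨monomial a 1, mem_expSet.mp ha⟩

lemma monomialClass_eq_zero {a : Fin n →₀ ℕ} (ha : a ∈ expSet I) (haJ : a ∈ expSet J) :
    monomialClass I J ha = 0 :=
  (Submodule.Quotient.mk_eq_zero _).mpr haJ

lemma exists_X_smul_monomialClass (i : Fin n) {a : Fin n →₀ ℕ} (ha : a ∈ expSet I) :
    ∃ h : a + .single i 1 ∈ expSet I,
      (X i : MvPolynomial (Fin n) K) • monomialClass I J ha = monomialClass I J h := by
  have hX : (X i : MvPolynomial (Fin n) K) * monomial a 1 = monomial (a + .single i 1) 1 := by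
    rw [X, monomial_mul, add_comm, one_mul]
  have hXI : a + .single i 1 ∈ expSet I := by
    rw [mem_expSet, ← hX]
    exact I.mul_mem_left _ (mem_expSet.mp ha)
  refine ⟨hXI, ?_⟩
  rw [monomialClass, ← Submodule.Quotient.mk_smul]
  exact congrArg _ (Subtype.ext hX)

lemma linearIndependent_monomialClass {Q : (Fin n →₀ ℕ) → Prop} (hJ : GenBy J Q) :
    LinearIndependent K fun a : ↥(expSet I \ expSet J) => monomialClass I J a.2.1 := by
  classical
  rw [linearIndependent_iff']
  intro s g hg a ha
  by_contra hga
  let p : I := ∑ a ∈ s, g a • ⟨monomial a.1 1, mem_expSet.mp a.2.1⟩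
  have hp : (p : MvPolynomial (Fin n) K) = ∑ a ∈ s, g a • monomial a.1 (1 : K) := by
    simp [p]
  have hsum : (Submodule.Quotient.mk p : I ⧸ Submodule.comap I.subtype J) = 0 := by
    rw [← hg, ← Submodule.mkQ_apply, map_sum]
    rfl
  have hpJ : (p : MvPolynomial (Fin n) K) ∈ J :=
    Submodule.mem_comap.mp ((Submodule.Quotient.mk_eq_zero _).mp hsum)
  refine a.2.2 (hJ.mem_iff.mp hpJ a.1 ?_)
  rw [mem_support_iff, hp, coeff_sum, Finset.sum_eq_single a]
  · simpa [coeff_monomial] using hga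
  · intro c _ hca
    simp [coeff_monomial, Subtype.val_inj, hca]
  · exact fun h => absurd ha h

lemma top_le_span_monomialClass {P : (Fin n →₀ ℕ) → Prop} (hI : GenBy I P) :
    ⊤ ≤ Submodule.span K
      (Set.range fun a : ↥(expSet I \ expSet J) => monomialClass I J a.2.1) := by
  rintro x -
  obtain ⟨⟨p, hp⟩, rfl⟩ := Submodule.Quotient.mk_surjective _ x
  have hmem := hI.mem_iff.mp hp
  have hsum : (⟨p, hp⟩ : I) = ∑ a ∈ p.support.attach,
      coeff a.1 p • ⟨monomial a.1 1, mem_expSet.mp (hmem a.1 a.2)⟩ := by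
    apply Subtype.ext
    simp [Finset.sum_attach p.support fun a => monomial a (coeff a p), smul_monomial,
      support_sum_monomial_coeff]
  rw [hsum, ← Submodule.mkQ_apply, map_sum]
  refine Submodule.sum_mem _ fun a _ => ?_
  rw [Submodule.mkQ_apply, Submodule.Quotient.mk_smul]
  refine Submodule.smul_mem _ _ ?_
  change monomialClass I J (hmem a.1 a.2) ∈ _
  by_cases haJ : a.1 ∈ expSet J
  · rw [monomialClass_eq_zero _ haJ]
    exact Submodule.zero_mem _
  · exact Submodule.subset_span ⟨⟨a.1, hmem a.1 a.2, haJ⟩, rfl⟩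

/-- The residue classes of the monomials in `I ∖ J` form a homogeneous basis of `I / J`. -/
lemma exists_isHomogeneousBasis {P Q : (Fin n →₀ ℕ) → Prop} (hI : GenBy I P) (hJ : GenBy J Q) :
    ∃ b : Module.Basis ↥(expSet I \ expSet J) K (I ⧸ Submodule.comap I.subtype J),
      IsHomogeneousBasis (n := n) b fun a => edeg a.1 := by
  refine ⟨Module.Basis.mk (linearIndependent_monomialClass hJ) (top_le_span_monomialClass hI),
    fun i a => ?_⟩
  obtain ⟨hXI, hX⟩ := exists_X_smul_monomialClass (J := J) i a.2.1
  rw [Module.Basis.mk_apply, hX]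
  by_cases haJ : a.1 + .single i 1 ∈ expSet J
  · exact .inl (monomialClass_eq_zero hXI haJ)
  · exact .inr ⟨⟨_, hXI, haJ⟩, by rw [Module.Basis.mk_apply], edeg_add_single _ _⟩

end MonomialQuotient

section SquarefreeHilbertSeries

lemma coeff_one_sub_X_pow (m k : ℕ) :
    PowerSeries.coeff k ((1 - PowerSeries.X : PowerSeries ℤ) ^ m) = (-1) ^ k * m.choose k := by
  have h : (1 - PowerSeries.X : PowerSeries ℤ) ^ m =
      PowerSeries.rescale (-1) (((1 + Polynomial.X) ^ m : Polynomial ℤ) : PowerSeries ℤ) := by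
    simp [sub_eq_add_neg, PowerSeries.rescale_X]
  rw [h, PowerSeries.coeff_rescale, Polynomial.coeff_coe, Polynomial.coeff_one_add_X_pow]

lemma coeff_one_sub_X_pow_mul_X_mul_mk_one_pow {r k : ℕ} (hkr : k ≤ r) (j : ℕ) :
    PowerSeries.coeff k ((1 - PowerSeries.X : PowerSeries ℤ) ^ r *
        (PowerSeries.X * PowerSeries.mk 1) ^ j) =
      if j ≤ k then (-1) ^ (k - j) * ((r - j).choose (k - j) : ℤ) else 0 := by
  rw [mul_pow, mul_left_comm, PowerSeries.coeff_X_pow_mul']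
  refine if_ctx_congr Iff.rfl (fun hjk => ?_) fun _ => rfl
  rw [← coeff_one_sub_X_pow, ← Nat.sub_add_cancel (hjk.trans hkr), pow_add, mul_assoc, ← mul_pow,
    mul_comm (1 - PowerSeries.X), PowerSeries.mk_one_mul_one_sub_eq_one, one_pow, mul_one,
    Nat.add_sub_cancel]

variable {n : ℕ}

/-- The Hilbert series of the span of the monomials with a given support. -/
lemma ncard_support_eq_and_edeg_eq (F : Finset (Fin n)) (k : ℕ) :
    ({a : Fin n →₀ ℕ | a.support = F ∧ edeg a = k}.ncard : ℤ) =
      PowerSeries.coeff k ((PowerSeries.X * PowerSeries.mk 1 : PowerSeries ℤ) ^ F.card) := by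
  classical
  have hcoeff (m : ℕ) : PowerSeries.coeff m (PowerSeries.X * PowerSeries.mk 1 : PowerSeries ℤ) =
      if m ≠ 0 then 1 else 0 := by
    cases m <;> simp [PowerSeries.coeff_succ_X_mul]
  have hset : {a : Fin n →₀ ℕ | a.support = F ∧ edeg a = k} =
      ↑((F.finsuppAntidiag k).filter fun a => ∀ i ∈ F, a i ≠ 0) := by
    ext a
    simp only [Set.mem_ofPred_eq, Finset.coe_filter, Finset.mem_finsuppAntidiag]
    constructor
    · rintro ⟨rfl, rfl⟩
      refine ⟨⟨?_, subset_rfl⟩, fun i hi => Finsupp.mem_support_iff.mp hi⟩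
      exact Finset.sum_subset (Finset.subset_univ _) (by simp)
    · rintro ⟨⟨rfl, hsub⟩, hF⟩
      refine ⟨hsub.antisymm fun i hi => Finsupp.mem_support_iff.mpr (hF i hi), ?_⟩
      refine (Finset.sum_subset (Finset.subset_univ _) fun i _ hi => ?_).symm
      exact Finsupp.notMem_support_iff.mp fun h => hi (hsub h)
  rw [hset, Set.ncard_coe_finset, Finset.card_filter, Nat.cast_sum, ← Finset.prod_const,
    PowerSeries.coeff_prod]
  refine Finset.sum_congr rfl fun a _ => ?_
  simp only [hcoeff, Finset.prod_ite_zero, Finset.prod_const_one]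
  push_cast
  rfl

variable {K : Type} [Field K] {I J : Ideal (MvPolynomial (Fin n) K)}

lemma GenBy.mem_expSet_of_support_eq {P : (Fin n →₀ ℕ) → Prop} (h : GenBy I P)
    (hP : ∀ a, P a → IsSqfree a) {a b : Fin n →₀ ℕ} (hab : a.support = b.support)
    (ha : a ∈ expSet I) : b ∈ expSet I := by
  obtain ⟨G, hG, hmem⟩ := h.mem_expSet_iff
  obtain ⟨g, hg, hga⟩ := (hmem a).mp ha
  refine (hmem b).mpr ⟨g, hg, fun i => ?_⟩
  have hi : i ∈ a.support ↔ i ∈ b.support := by rw [hab]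
  rw [Finsupp.mem_support_iff, Finsupp.mem_support_iff] at hi
  have := hP g (hG g hg) i
  have := hga i
  omega

lemma edeg_indicator_one (F : Finset (Fin n)) :
    edeg (Finsupp.indicator F fun _ _ => 1) = F.card := by
  simp [edeg, Finsupp.indicator_apply]

lemma support_indicator_one (F : Finset (Fin n)) :
    (Finsupp.indicator F fun _ _ => 1 : Fin n →₀ ℕ).support = F := by
  ext i
  simp [Finsupp.indicator_apply]

lemma IsSqfree.eq_indicator {a : Fin n →₀ ℕ} (ha : IsSqfree a) :
    a = Finsupp.indicator a.support fun _ _ => 1 := by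
  ext i
  have := ha i
  simp only [Finsupp.indicator_apply, Finsupp.mem_support_iff]
  split_ifs <;> omega

open Classical in
/-- The supports of the squarefree monomials in `I ∖ J`. -/
def supportsDiff (I J : Ideal (MvPolynomial (Fin n) K)) : Finset (Finset (Fin n)) :=
  {F | (Finsupp.indicator F fun _ _ => 1) ∈ expSet I \ expSet J}

lemma mem_supportsDiff {F : Finset (Fin n)} :
    F ∈ supportsDiff I J ↔ (Finsupp.indicator F fun _ _ => 1) ∈ expSet I \ expSet J := by
  simp [supportsDiff]

lemma rho_eq_card (j : ℕ) : rho I J j = ((supportsDiff I J).filter fun F => F.card = j).card := by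
  rw [rho, ← Set.ncard_coe_finset]
  refine Set.ncard_congr (fun a _ => a.support) ?_ ?_ ?_
  · rintro a ⟨hsq, rfl, hI, hJ⟩
    have hcard := edeg_indicator_one a.support
    rw [Finset.mem_coe, Finset.mem_filter, mem_supportsDiff]
    rw [← hsq.eq_indicator] at hcard ⊢
    exact ⟨⟨hI, hJ⟩, hcard.symm⟩
  · intro a b ha hb hab
    rw [ha.1.eq_indicator, hb.1.eq_indicator, hab]
  · intro F hF
    rw [Finset.mem_coe, Finset.mem_filter, mem_supportsDiff] at hF
    refine ⟨_, ⟨fun i => ?_, (edeg_indicator_one F).trans hF.2, hF.1.1, hF.1.2⟩,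
      support_indicator_one F⟩
    rw [Finsupp.indicator_apply]
    split_ifs <;> simp

/-- The Hilbert series of `I / J` for squarefree monomial ideals. -/
lemma mk_ncard_expSet_diff {P Q : (Fin n →₀ ℕ) → Prop} (hI : GenBy I P) (hJ : GenBy J Q)
    (hP : ∀ a, P a → IsSqfree a) (hQ : ∀ a, Q a → IsSqfree a) :
    (PowerSeries.mk fun k => ({a : ↥(expSet I \ expSet J) | edeg a.1 = k}.ncard : ℤ)) =
      ∑ F ∈ supportsDiff I J, (PowerSeries.X * PowerSeries.mk 1) ^ F.card := by
  classical
  ext k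
  have hmem (a : Fin n →₀ ℕ) : a.support ∈ supportsDiff I J ↔ a ∈ expSet I \ expSet J := by
    have h := support_indicator_one a.support
    rw [mem_supportsDiff, Set.mem_sdiff, Set.mem_sdiff]
    exact and_congr
      ⟨hI.mem_expSet_of_support_eq hP h, hI.mem_expSet_of_support_eq hP h.symm⟩
      (not_congr ⟨hJ.mem_expSet_of_support_eq hQ h, hJ.mem_expSet_of_support_eq hQ h.symm⟩)
  have hfin := finite_edeg_eq (n := n) k
  have hleft : {a : ↥(expSet I \ expSet J) | edeg a.1 = k}.ncard =
      (hfin.toFinset.filter fun a => a.support ∈ supportsDiff I J).card := by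
    rw [← Set.ncard_image_of_injective _ Subtype.val_injective, ← Set.ncard_coe_finset]
    congr 1
    ext a
    simp only [Set.mem_image, Finset.coe_filter, hmem, Set.Finite.mem_toFinset, Set.mem_ofPred_eq]
    exact ⟨fun ⟨c, hc, hca⟩ => hca ▸ ⟨hc, c.2⟩, fun ⟨hk, ha⟩ => ⟨⟨a, ha⟩, hk, rfl⟩⟩
  have hmaps : Set.MapsTo Finsupp.support
      (hfin.toFinset.filter fun a => a.support ∈ supportsDiff I J : Set (Fin n →₀ ℕ))
      (supportsDiff I J : Set (Finset (Fin n))) :=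
    fun a ha => (Finset.mem_filter.mp ha).2
  rw [PowerSeries.coeff_mk, hleft, map_sum, Finset.card_eq_sum_card_fiberwise hmaps, Nat.cast_sum]
  refine Finset.sum_congr rfl fun F hF => ?_
  rw [← ncard_support_eq_and_edeg_eq, ← Set.ncard_coe_finset]
  congr 2
  ext a
  simp only [Finset.coe_filter, Finset.mem_filter, Set.Finite.mem_toFinset, Set.mem_ofPred_eq]
  exact ⟨fun h => ⟨h.2, h.1.1⟩, fun h => ⟨⟨h.2, h.1 ▸ hF⟩, h.1⟩⟩

lemma coeff_one_sub_X_pow_mul_mk_ncard {P Q : (Fin n →₀ ℕ) → Prop} (hI : GenBy I P)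
    (hJ : GenBy J Q) (hP : ∀ a, P a → IsSqfree a) (hQ : ∀ a, Q a → IsSqfree a) {r k : ℕ}
    (hkr : k ≤ r) :
    PowerSeries.coeff k ((1 - PowerSeries.X) ^ r *
        PowerSeries.mk fun k => ({a : ↥(expSet I \ expSet J) | edeg a.1 = k}.ncard : ℤ)) =
      ∑ j ∈ Finset.range (k + 1),
        (-1) ^ (k - j) * ((r - j).choose (k - j) : ℤ) * (rho I J j : ℤ) := by
  rw [mk_ncard_expSet_diff hI hJ hP hQ, Finset.mul_sum, map_sum,
    Finset.sum_congr rfl fun F _ => coeff_one_sub_X_pow_mul_X_mul_mk_one_pow hkr F.card]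
  rw [← Finset.sum_filter, ← Finset.sum_fiberwise_of_maps_to (g := Finset.card)
    (t := Finset.range (k + 1)) (by simp)]
  refine Finset.sum_congr rfl fun j hj => ?_
  rw [Finset.filter_filter, rho_eq_card, Finset.card_eq_sum_ones, Nat.cast_sum, Finset.mul_sum]
  refine Finset.sum_congr ?_ fun F hF => ?_
  · refine Finset.filter_congr fun F _ => ?_
    rw [Finset.mem_range] at hj
    omega
  · rw [(Finset.mem_filter.mp hF).2]
    simp

lemma rho_eq_zero_of_lt {d j : ℕ} (hI : GenBy I fun a => IsSqfree a ∧ d ≤ edeg a) (hj : j < d) :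
    rho I J j = 0 := by
  obtain ⟨G, hG, hmem⟩ := hI.mem_expSet_iff
  rw [rho, Set.ncard_eq_zero ((finite_edeg_eq j).subset fun a ha => ha.2.1)]
  refine Set.eq_empty_of_forall_notMem fun a ha => ?_
  obtain ⟨g, hg, hga⟩ := (hmem a).mp ha.2.2.1
  have hle : edeg g ≤ edeg a := Finset.sum_le_sum fun i _ => hga i
  have := (hG g hg).2
  have := ha.2.1
  omega

end SquarefreeHilbertSeries

lemma exists_isWeaklyRegular_of_lt_mdepth {K : Type} [Field K] {n r : ℕ} {M : Type}
    [AddCommGroup M] [Module (MvPolynomial (Fin n) K) M] (h : (r : ℕ∞) < mdepth K n M) :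
    ∃ rs : List (MvPolynomial (Fin n) K), (∀ f ∈ rs, f ∈ maxIdeal K n) ∧
      RingTheory.Sequence.IsWeaklyRegular M rs ∧ rs.length = r + 1 := by
  obtain ⟨_, ⟨rs, hmem, hreg, rfl⟩, hlt⟩ := lt_sSup_iff.mp h
  rw [Nat.cast_lt] at hlt
  have hweak := hreg.toIsWeaklyRegular
  rw [← List.take_append_drop (r + 1) rs, RingTheory.Sequence.isWeaklyRegular_append_iff] at hweak
  exact ⟨rs.take (r + 1), fun f hf => hmem f (List.mem_of_mem_take hf), hweak.1,
    by rw [List.length_take]; omega⟩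

/-- Theorem `popescu-gen`. Let `J ⊊ I` be squarefree monomial ideals of
`S = K[x_1,…,x_n]`, generated by monomials of degrees `≥ d` and `≥ d+1` respectively.
Assume `depth_S(I/J) ≥ t` where `d ≤ t < n`. If for some `k` with `d+1 ≤ k ≤ t+1` one has
`ρ_k(I∖J) < ∑_{j=d}^{k-1} (-1)^{k-j+1} C(t+1-j, k-j) ρ_j(I∖J)`, then `depth_S(I/J) = t`,
independently of the characteristic of `K`. -/
theorem depth_eq_of_rho_lt {K : Type} [Field K] {n d t k : ℕ}
    (I J : Ideal (MvPolynomial (Fin n) K)) (hJI : J < I)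
    (hsqI : GenBy I (fun a => IsSqfree a ∧ d ≤ edeg a))
    (hsqJ : GenBy J (fun a => IsSqfree a ∧ d + 1 ≤ edeg a))
    (hdt : d ≤ t) (htn : t < n)
    (hdepth : (t : ℕ∞) ≤ mdepth K n (quotMod I J))
    (hk1 : d + 1 ≤ k) (hk2 : k ≤ t + 1)
    (hineq : (rho I J k : ℤ) < ∑ j ∈ Finset.Icc d (k - 1),
      (-1 : ℤ) ^ (k - j + 1) * ((t + 1 - j).choose (k - j) : ℤ) * (rho I J j : ℤ)) :
    mdepth K n (quotMod I J) = t := by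
  by_contra hne
  obtain ⟨rs, hmem, hreg, hlen⟩ :=
    exists_isWeaklyRegular_of_lt_mdepth (lt_of_le_of_ne hdepth (Ne.symm hne))
  obtain ⟨b, hb⟩ := exists_isHomogeneousBasis hsqI hsqJ
  have hfin (m : ℕ) : {a : ↥(expSet I \ expSet J) | edeg a.1 = m}.Finite :=
    (finite_edeg_eq m).preimage Subtype.val_injective.injOn
  have hnonneg := hb.coeff_one_sub_pow_mul_nonneg hfin hmem hreg k
  rw [hlen, coeff_one_sub_X_pow_mul_mk_ncard hsqI hsqJ (fun _ h => h.1) (fun _ h => h.1) hk2,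
    Finset.sum_range_succ, Nat.sub_self, pow_zero, Nat.choose_zero_right, Nat.cast_one, one_mul,
    one_mul] at hnonneg
  have hsum : ∑ j ∈ Finset.range k,
      (-1) ^ (k - j) * ((t + 1 - j).choose (k - j) : ℤ) * (rho I J j : ℤ) =
      -∑ j ∈ Finset.Icc d (k - 1),
        (-1 : ℤ) ^ (k - j + 1) * ((t + 1 - j).choose (k - j) : ℤ) * (rho I J j : ℤ) := by
    rw [← Finset.sum_neg_distrib]
    symm
    refine Finset.sum_subset_zero_on_sdiff (fun j hj => ?_) (fun j hj => ?_) fun j _ => ?_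
    · rw [Finset.mem_Icc] at hj
      rw [Finset.mem_range]
      omega
    · rw [Finset.mem_sdiff, Finset.mem_range, Finset.mem_Icc] at hj
      rw [rho_eq_zero_of_lt hsqI (by omega), Nat.cast_zero, mul_zero]
    · ring
  rw [hsum] at hnonneg
  linarith
end
end
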